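/- arXiv:2605.18202 — 3 statements merged into one kernel-verified Lean document; each statement's English description precedes it below -/
import Mathlib

section
/- For all subsets Γ ⊆ C and Υ ⊆ Y, the joint revision operator satisfies R(R(Γ, Υ)) = R(Γ, Υ); that is, the pair (Γ ∩ g⁻†(Υ), Υ ∩ g†(Γ)) is a fixed point of R, so a single application of the revision suffices and no further iteration changes the result. -/
/-- Abduction: concepts entailing at least one label in `Υ`. -/
def abduce {C Y : Type*} (G : C → Set Y) (Υ : Set Y) : Set C :=
  {c : C | ∃ y ∈ Υ, y ∈ G c}

/-- Deduction: labels entailed by at least one concept in `Γ`. -/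
def deduce {C Y : Type*} (G : C → Set Y) (Γ : Set C) : Set Y :=
  {y : Y | ∃ c ∈ Γ, y ∈ G c}

/-- The joint revision operator `R(Γ, Υ) = (Γ ∩ g⁻†(Υ), Υ ∩ g†(Γ))`. -/
def revise {C Y : Type*} (G : C → Set Y) (p : Set C × Set Y) : Set C × Set Y :=
  (p.1 ∩ abduce G p.2, p.2 ∩ deduce G p.1)

/-- One-step fixed point: a single application of the joint revision operator
suffices, i.e. `R(R(Γ, Υ)) = R(Γ, Υ)`. -/
theorem revise_fixed_point {C Y : Type*} (G : C → Set Y)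
    (Γ : Set C) (Υ : Set Y) :
    revise G (revise G (Γ, Υ)) = revise G (Γ, Υ) := by
  refine Prod.ext (Set.inter_eq_left.2 ?_) (Set.inter_eq_left.2 ?_)
  · rintro c ⟨hc, y, hy, hcy⟩
    exact ⟨y, ⟨hy, c, hc, hcy⟩, hcy⟩
  · rintro y ⟨hy, c, hc, hcy⟩
    exact ⟨c, ⟨hc, y, hy, hcy⟩, hcy⟩
end

section
/- Let A_Y, A_C, and B be measurable events in a probability space (Ω, 𝓕, P), let 0 < α < 1 and 0 < β < 1, assume P(A_Y) ≥ 1 − α and P(A_C) ≥ 1 − β, and set δ_ab := P(B | A_Y). Then P(A_C ∩ B) ≥ (1 − α)·δ_ab − β + P(A_Cᶜ ∩ Bᶜ). (Interpreting A_Y as the event that the ground-truth label lies in the conformal label set Υ_α(x), A_C as the event that the ground-truth concept vector lies in the conformal concept set Γ_β(x), and B as the event that the ground-truth concept vector lies in the abduced set Γ^ab(x) = g⁻†(Υ_α(x)), this is the marginal coverage bound for the jointly revised concept set Γ^rev(x) = Γ_β(x) ∩ Γ^ab(x).) -/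
open MeasureTheory

/-- Inclusion-exclusion for two events, with the union replaced by its complement. -/
theorem probReal_inter_eq_add_sub_one_add_compl_inter_compl {Ω : Type*} [MeasurableSpace Ω]
    (P : Measure Ω) [IsProbabilityMeasure P] {A B : Set Ω}
    (hA : MeasurableSet A) (hB : MeasurableSet B) :
    P.real (A ∩ B) = P.real A + P.real B - 1 + P.real (Aᶜ ∩ Bᶜ) := by
  rw [← Set.compl_union, probReal_compl_eq_one_sub (hA.union hB)]
  linarith [measureReal_union_add_inter (μ := P) (s := A) hB]

/-- Marginal coverage of the jointly revised concept set: if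
`P(A_Y) ≥ 1 - α`, `P(A_C) ≥ 1 - β` and `δ_ab = P(B | A_Y)`, then
`P(A_C ∩ B) ≥ (1 - α)·δ_ab - β + P(A_Cᶜ ∩ Bᶜ)`. -/
theorem revised_concept_set_coverage {Ω : Type*} [MeasurableSpace Ω]
    (P : Measure Ω) [IsProbabilityMeasure P]
    (AY AC B : Set Ω)
    (hAY : MeasurableSet AY) (hAC : MeasurableSet AC) (hB : MeasurableSet B)
    (α β : ℝ) (hα0 : 0 < α) (hα1 : α < 1) (hβ0 : 0 < β) (hβ1 : β < 1)
    (hcovY : 1 - α ≤ (P AY).toReal) (hcovC : 1 - β ≤ (P AC).toReal) :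
    (1 - α) * ((P (AY ∩ B)).toReal / (P AY).toReal) - β
        + (P (ACᶜ ∩ Bᶜ)).toReal ≤ (P (AC ∩ B)).toReal := by
  simp only [← measureReal_def] at hcovY hcovC ⊢
  have hpos : 0 < P.real AY := by linarith
  have hcond : (1 - α) * (P.real (AY ∩ B) / P.real AY) ≤ P.real B :=
    calc (1 - α) * (P.real (AY ∩ B) / P.real AY)
        ≤ P.real AY * (P.real (AY ∩ B) / P.real AY) := by gcongr
      _ = P.real (AY ∩ B) := mul_div_cancel₀ _ hpos.ne'
      _ ≤ P.real B := measureReal_mono Set.inter_subset_right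
  linarith [probReal_inter_eq_add_sub_one_add_compl_inter_compl P hAC hB]
end

section
/- Let A_C, A_Y, and B be measurable events in a probability space (Ω, 𝓕, P), let 0 < α < 1 and 0 < β < 1, assume P(A_Y) ≥ 1 − α and P(A_C) ≥ 1 − β, and set δ_de := P(B | A_C). Then P(A_Y ∩ B) ≥ (1 − β)·δ_de − α + P(A_Yᶜ ∩ Bᶜ). (Interpreting A_C as the event that the ground-truth concept vector lies in the conformal concept set Γ_β(x), A_Y as the event that the ground-truth label lies in the conformal label set Υ_α(x), and B as the event that the ground-truth label lies in the deduced set Υ^de(x) = g†(Γ_β(x)), this is the marginal coverage bound for the jointly revised label set Υ^rev(x) = Υ_α(x) ∩ Υ^de(x).) -/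
open MeasureTheory

/-- Marginal coverage of the jointly revised label set: if
`P(A_Y) ≥ 1 - α`, `P(A_C) ≥ 1 - β` and `δ_de = P(B | A_C)`, then
`P(A_Y ∩ B) ≥ (1 - β)·δ_de - α + P(A_Yᶜ ∩ Bᶜ)`. -/
theorem revised_label_set_coverage {Ω : Type*} [MeasurableSpace Ω]
    (P : Measure Ω) [IsProbabilityMeasure P]
    (AC AY B : Set Ω)
    (hAC : MeasurableSet AC) (hAY : MeasurableSet AY) (hB : MeasurableSet B)
    (α β : ℝ) (hα0 : 0 < α) (hα1 : α < 1) (hβ0 : 0 < β) (hβ1 : β < 1)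
    (hcovY : 1 - α ≤ (P AY).toReal) (hcovC : 1 - β ≤ (P AC).toReal) :
    (1 - β) * ((P (AC ∩ B)).toReal / (P AC).toReal) - α
        + (P (AYᶜ ∩ Bᶜ)).toReal ≤ (P (AY ∩ B)).toReal := by
  simp only [← measureReal_def] at *
  have hpos : 0 < P.real AC := by linarith
  have hdeduced : (1 - β) * (P.real (AC ∩ B) / P.real AC) ≤ P.real B :=
    calc (1 - β) * (P.real (AC ∩ B) / P.real AC)
        ≤ P.real AC * (P.real (AC ∩ B) / P.real AC) := by gcongr
      _ = P.real (AC ∩ B) := mul_div_cancel₀ _ hpos.ne'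
      _ ≤ P.real B := measureReal_mono Set.inter_subset_right
  have hunion : P.real (AY ∪ B) + P.real (AY ∩ B) = P.real AY + P.real B :=
    measureReal_union_add_inter hB
  have hcompl : P.real (AYᶜ ∩ Bᶜ) = 1 - P.real (AY ∪ B) := by
    rw [← Set.compl_union, probReal_compl_eq_one_sub (hAY.union hB)]
  linarith
end
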